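/- arXiv:2010.12306 — 2 statements merged into one kernel-verified Lean document; each statement's English description precedes it below -/
import Mathlib

section
/- Let d be any real number with 0 < d < -log(e^{R(f^o)} - 1) and set Δ = log(1 + e^{-d}). Assume additionally that ρ_N^{(k)} < d and ρ_N^{(k)} < (Δ - R(f^o))/2 for every agent k. Then the probability, over all agents' independent training samples, that simultaneously μ^+(f̃^N) > μ̃^N(f̃^N) and μ^-(f̃^N) < μ̃^N(f̃^N), is at least 1 - 2·Σ_{k=1}^K exp( -(d - ρ_N^{(k)})² N_k / (2B²) ) - Σ_{k=1}^K exp( -((Δ - R(f^o))/2 - ρ_N^{(k)})² N_k / (2B²) ). -/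
open MeasureTheory

/-- The real sign `±1` associated with a Boolean: `true ↦ +1`, `false ↦ −1`. -/
def rsign (b : Bool) : ℝ := if b then 1 else -1

lemma sml_int_bdd {X : Type*} [MeasurableSpace X] (μ : Measure X) [IsFiniteMeasure μ] {f : X → ℝ}
    (hm : Measurable f) (C : ℝ) (hb : ∀ x, |f x| ≤ C) : Integrable f μ :=
  Integrable.of_bound hm.aestronglyMeasurable C (ae_of_all _ hb)

lemma sml_abs_integral_le {X : Type*} [MeasurableSpace X] (μ : Measure X) [IsProbabilityMeasure μ]
    {f : X → ℝ} (C : ℝ) (hb : ∀ x, |f x| ≤ C) : |∫ x, f x ∂μ| ≤ C := by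
  have := norm_integral_le_of_norm_le_const (μ := μ) (f := f) (C := C) (ae_of_all _ hb)
  simpa using this

lemma sml_meas_cons {X : Type*} [MeasurableSpace X] (n : ℕ) :
    Measurable (fun p : X × (Fin n → X) => (Fin.cons p.1 p.2 : Fin (n+1) → X)) := by
  rw [measurable_pi_iff]
  intro i
  refine Fin.cases ?_ (fun j => ?_) i
  · simpa using measurable_fst
  · simp only [Fin.cons_succ]
    exact (measurable_pi_apply j).comp measurable_snd

lemma sml_int_succ {X : Type*} [MeasurableSpace X] (ν : Measure X) [IsProbabilityMeasure ν] (n : ℕ)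
    (h : (Fin (n+1) → X) → ℝ) (hm : Measurable h) (C : ℝ) (hb : ∀ x, |h x| ≤ C) :
    ∫ ω, h ω ∂(Measure.pi fun _ : Fin (n+1) => ν)
      = ∫ x, ∫ y, h (Fin.cons x y) ∂(Measure.pi fun _ : Fin n => ν) ∂ν := by
  have mp := (measurePreserving_piFinSuccAbove (fun _ : Fin (n+1) => ν) 0).symm
  have h1 := mp.integral_comp' h
  rw [← h1]
  have he : ∀ p : X × (Fin n → X), (MeasurableEquiv.piFinSuccAbove (fun _ : Fin (n+1) => X) 0).symm p
      = (Fin.cons p.1 p.2 : Fin (n+1) → X) := by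
    intro p
    simp [MeasurableEquiv.piFinSuccAbove, Fin.insertNthEquiv]
  simp only [he]
  rw [integral_prod]
  · exact sml_int_bdd _ (hm.comp (sml_meas_cons n)) C (fun x => hb _)

lemma sml_hoeffding {X : Type*} [MeasurableSpace X] (ν : Measure X) [IsProbabilityMeasure ν]
    (g : X → ℝ) (hm : Measurable g) (C : ℝ) (hb : ∀ x, |g x| ≤ C) (c : ℝ) (hc : 0 ≤ c)
    (hd : ∀ x y, g x - g y ≤ c) (t : ℝ) :
    ∫ x, Real.exp (t * (g x - ∫ z, g z ∂ν)) ∂ν ≤ Real.exp (t ^ 2 * c ^ 2 / 8) := by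
  have hne : Nonempty X := nonempty_of_isProbabilityMeasure ν
  have hbd : BddBelow (Set.range g) := ⟨-C, by rintro _ ⟨x, rfl⟩; exact (abs_le.1 (hb x)).1⟩
  have h := ProbabilityTheory.hasSubgaussianMGF_of_mem_Icc (μ := ν) (X := g)
    (a := ⨅ x, g x) (b := (⨅ x, g x) + c) hm.aemeasurable (ae_of_all _ (fun x => ⟨ciInf_le hbd x, by
      have : g x - c ≤ ⨅ y, g y := le_ciInf (fun y => by linarith [hd x y])
      linarith⟩))
  have h2 := h.mgf_le t
  simp only [ProbabilityTheory.mgf, add_sub_cancel_left] at h2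
  refine h2.trans (le_of_eq ?_)
  congr 1
  push_cast
  rw [Real.norm_eq_abs, abs_of_nonneg hc]
  ring

lemma sml_mcd {X : Type*} [MeasurableSpace X] (ν : Measure X) [IsProbabilityMeasure ν]
    (c : ℝ) (hc : 0 ≤ c) (C : ℝ) (t : ℝ) (n : ℕ) : ∀ 
    (f : (Fin n → X) → ℝ) (_ : Measurable f) (_ : ∀ x, |f x| ≤ C) 
    (_ : ∀ x y m, (∀ j, j ≠ m → x j = y j) → f x - f y ≤ c),
    ∫ ω, Real.exp (t * (f ω - ∫ z, f z ∂(Measure.pi fun _ : Fin n => ν)))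
      ∂(Measure.pi fun _ : Fin n => ν) ≤ Real.exp (t ^ 2 * (n * c ^ 2) / 8) := by
  induction n with
  | zero =>
    intro f hm hb hd
    have : ∀ x, f x = f (fun i => i.elim0) := fun x => by congr 1; exact Subsingleton.elim _ _
    simp [this]
  | succ n ih =>
    intro f hm hb hd
    set P := Measure.pi fun _ : Fin n => ν with hP
    set m := ∫ z, f z ∂(Measure.pi fun _ : Fin (n+1) => ν) with hm'
    let g : X → ℝ := fun x => ∫ y, f (Fin.cons x y) ∂P
    have hfc : Measurable (fun p : X × (Fin n → X) => f (Fin.cons p.1 p.2)) :=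
      hm.comp (sml_meas_cons n)
    have hfx : ∀ x, Measurable (fun y : Fin n → X => f (Fin.cons x y)) := fun x =>
      hfc.comp measurable_prodMk_left
    have hgm : Measurable g := hfc.stronglyMeasurable.integral_prod_right.measurable
    have hgb : ∀ x, |g x| ≤ C := fun x => sml_abs_integral_le _ C (fun y => hb _)
    have hmg : m = ∫ x, g x ∂ν := sml_int_succ ν n f hm C hb
    have hmb : |m| ≤ C := sml_abs_integral_le _ C hb
    have hgd : ∀ x y, g x - g y ≤ c := by
      intro x y
      simp only [g]
      rw [← integral_sub (sml_int_bdd _ (hfx x) C (fun _ => hb _))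
        (sml_int_bdd _ (hfx y) C (fun _ => hb _))]
      calc _ ≤ ∫ z, c ∂P := by
            apply integral_mono
            · exact (sml_int_bdd _ (hfx x) C (fun _ => hb _)).sub
                (sml_int_bdd _ (hfx y) C (fun _ => hb _))
            · exact integrable_const _
            · intro z
              apply hd _ _ 0
              intro j hj
              obtain ⟨k, rfl⟩ := Fin.exists_succ_eq.2 hj
              simp
        _ = c := by simp
    have hexpb : ∀ u v : ℝ, |u| ≤ C → |v| ≤ C → |Real.exp (t * (u - v))| ≤ Real.exp (|t| * (2 * C)) := by
      intro u v hu hv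
      rw [Real.abs_exp]
      apply Real.exp_le_exp.2
      refine (le_abs_self _).trans ?_
      rw [abs_mul]
      gcongr
      exact (abs_sub _ _).trans (by linarith)
    rw [sml_int_succ ν n _ (by fun_prop) (Real.exp (|t| * (2 * C))) (fun x => hexpb _ _ (hb _) hmb)]
    have key : ∀ x, ∫ y, Real.exp (t * (f (Fin.cons x y) - m)) ∂P
        ≤ Real.exp (t ^ 2 * (n * c ^ 2) / 8) * Real.exp (t * (g x - m)) := by
      intro x
      have h1 := ih (fun y => f (Fin.cons x y)) (hfx x) (fun _ => hb _) (by
        intro a b k hab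
        apply hd _ _ k.succ
        intro j
        refine Fin.cases ?_ (fun l => ?_) j
        · simp
        · intro hl
          simp only [Fin.cons_succ]
          exact hab l (fun h => hl (by rw [h])))
      calc ∫ y, Real.exp (t * (f (Fin.cons x y) - m)) ∂P
          = ∫ y, Real.exp (t * (f (Fin.cons x y) - g x)) * Real.exp (t * (g x - m)) ∂P := by
            congr 1; ext y; rw [← Real.exp_add]; congr 1; ring
        _ = (∫ y, Real.exp (t * (f (Fin.cons x y) - g x)) ∂P) * Real.exp (t * (g x - m)) :=
            integral_mul_const _ _
        _ ≤ _ := by gcongr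
    have h2 := sml_hoeffding ν g hgm C hgb c hc hgd t
    rw [← hmg] at h2
    have hi : Integrable (fun x => Real.exp (t * (g x - m))) ν :=
      sml_int_bdd _ (by fun_prop) _ (fun x => hexpb _ _ (hgb x) hmb)
    have hmeas2 : Measurable (fun x => ∫ y, Real.exp (t * (f (Fin.cons x y) - m)) ∂P) := by
      have : Measurable (fun p : X × (Fin n → X) => Real.exp (t * (f (Fin.cons p.1 p.2) - m))) :=
        Real.measurable_exp.comp ((hfc.sub_const m).const_mul t)
      exact this.stronglyMeasurable.integral_prod_right.measurable
    calc _ ≤ ∫ x, Real.exp (t ^ 2 * (n * c ^ 2) / 8) * Real.exp (t * (g x - m)) ∂ν := by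
          apply integral_mono
          · exact sml_int_bdd _ hmeas2 _ (fun x => sml_abs_integral_le _ _
              (fun y => hexpb _ _ (hb _) hmb))
          · exact hi.const_mul _
          · exact key
      _ = Real.exp (t ^ 2 * (n * c ^ 2) / 8) * ∫ x, Real.exp (t * (g x - m)) ∂ν :=
          integral_const_mul _ _
      _ ≤ Real.exp (t ^ 2 * (n * c ^ 2) / 8) * Real.exp (t ^ 2 * c ^ 2 / 8) := by gcongr
      _ = _ := by rw [← Real.exp_add]; congr 1; push_cast; ring

lemma sml_mcd_tail {X : Type*} [MeasurableSpace X] (ν : Measure X) [IsProbabilityMeasure ν]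
    (B : ℝ) (hB : 0 < B) (C : ℝ) (n : ℕ) (hn : 0 < n)
    (f : (Fin n → X) → ℝ) (hm : Measurable f) (hb : ∀ x, |f x| ≤ C) 
    (hd : ∀ x y m, (∀ j, j ≠ m → x j = y j) → f x - f y ≤ 2 * B / n)
    (r d : ℝ) (hr : ∫ z, f z ∂(Measure.pi fun _ : Fin n => ν) ≤ r) (hrd : r ≤ d) :
    (Measure.pi fun _ : Fin n => ν).real {ω | d ≤ f ω}
      ≤ Real.exp (-((d - r) ^ 2 * (n : ℝ)) / (2 * B ^ 2)) := by
  set P := Measure.pi fun _ : Fin n => ν with hP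
  set m := ∫ z, f z ∂P with hm'
  have hn' : (0 : ℝ) < n := by exact_mod_cast hn
  have hsub : ProbabilityTheory.HasSubgaussianMGF (fun ω => f ω - m)
      (Real.toNNReal (B ^ 2 / n)) P := by
    constructor
    · intro t
      have hmb : |m| ≤ C := sml_abs_integral_le _ C hb
      refine sml_int_bdd _ (by fun_prop) (Real.exp (|t| * (2 * C))) (fun ω => ?_)
      rw [Real.abs_exp]
      apply Real.exp_le_exp.2
      refine (le_abs_self _).trans ?_
      rw [abs_mul]
      gcongr
      exact (abs_sub _ _).trans (by linarith [hb ω])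
    · intro t
      refine (sml_mcd ν (2 * B / n) (by positivity) C t n f hm hb hd).trans (le_of_eq ?_)
      rw [Real.coe_toNNReal _ (by positivity)]
      congr 1
      field_simp
      norm_num
  have h1 := hsub.measure_ge_le (ε := d - r) (by linarith)
  rw [Real.coe_toNNReal _ (by positivity)] at h1
  calc P.real {ω | d ≤ f ω} ≤ P.real {ω | d - r ≤ f ω - m} := by
        apply measureReal_mono
        · intro ω hω
          simp only [Set.mem_ofPred_eq] at *
          linarith
        · exact measure_ne_top _ _
    _ ≤ _ := h1
    _ = _ := by congr 1; field_simp

lemma sml_two_point {ι : Type*} [Nonempty ι] (c u : ι → ℝ) (φ : ℝ → ℝ)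
    (hφ : ∀ x y, |φ x - φ y| ≤ |x - y|) (M : ℝ) (hc : ∀ i, |c i| ≤ M) (hu : ∀ i, |u i| ≤ M) :
    (⨆ i, (c i + φ (u i))) + (⨆ i, (c i - φ (u i))) ≤ (⨆ i, (c i + u i)) + (⨆ i, (c i - u i)) := by
  have b1 : BddAbove (Set.range fun i => c i + u i) := ⟨M + M, by
    rintro _ ⟨i, rfl⟩; have := abs_le.1 (hc i); have := abs_le.1 (hu i); simp only; linarith⟩
  have b2 : BddAbove (Set.range fun i => c i - u i) := ⟨M + M, by
    rintro _ ⟨i, rfl⟩; have := abs_le.1 (hc i); have := abs_le.1 (hu i); simp only; linarith⟩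
  rw [← le_sub_iff_add_le]
  apply ciSup_le
  intro i
  rw [le_sub_comm]
  apply ciSup_le
  intro j
  have h1 := le_ciSup b1 i
  have h2 := le_ciSup b2 i
  have h3 := le_ciSup b1 j
  have h4 := le_ciSup b2 j
  have h5 := (abs_le.1 (hφ (u i) (u j))).2
  rcases abs_cases (u i - u j) with h | h <;> linarith

lemma sml_rsign_abs (b : Bool) : |rsign b| = 1 := by cases b <;> simp [rsign]

lemma sml_contraction {ι : Type*} [Nonempty ι] (M : ℝ) (n : ℕ) : ∀ (a : ι → ℝ) (A : ℝ)
    (_ : ∀ i, |a i| ≤ A)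
    (φ : Fin n → ℝ → ℝ) (_ : ∀ m x y, |φ m x - φ m y| ≤ |x - y|)
    (u : ι → Fin n → ℝ) (_ : ∀ i m, |u i m| ≤ M),
    ∑ s : Fin n → Bool, (⨆ i, (a i + ∑ m, rsign (s m) * φ m (u i m)))
      ≤ ∑ s : Fin n → Bool, (⨆ i, (a i + ∑ m, rsign (s m) * u i m)) := by
  induction n with
  | zero => intro a A ha φ hφ u hu; simp
  | succ n ih =>
    intro a A ha φ hφ u hu
    rw [← (Fin.consEquiv (fun _ => Bool)).sum_comp, ← (Fin.consEquiv (fun _ => Bool)).sum_comp,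
      Fintype.sum_prod_type, Fintype.sum_prod_type]
    simp only [Fin.consEquiv_apply, Fin.sum_univ_succ, Fin.cons_zero, Fin.cons_succ]
    have hφb : ∀ i, |φ 0 (u i 0)| ≤ |φ 0 0| + M := by
      intro i
      have h1 := hφ 0 (u i 0) 0
      have h2 := hu i 0
      rw [sub_zero] at h1
      have := abs_sub_abs_le_abs_sub (φ 0 (u i 0)) (φ 0 0)
      linarith
    have step1 : ∀ b : Bool, ∑ s : Fin n → Bool, (⨆ i, (a i + (rsign b * φ 0 (u i 0) +
          ∑ m, rsign (s m) * φ m.succ (u i m.succ)))) ≤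
        ∑ s : Fin n → Bool, (⨆ i, (a i + rsign b * φ 0 (u i 0) +
          ∑ m, rsign (s m) * (u i m.succ))) := by
      intro b
      simp only [← add_assoc]
      apply ih (fun i => a i + rsign b * φ 0 (u i 0)) (A + (|φ 0 0| + M))
      · intro i
        refine (abs_add_le _ _).trans ?_
        rw [abs_mul, sml_rsign_abs, one_mul]
        exact add_le_add (ha i) (hφb i)
      · intro m; exact hφ _
      · intro i m; exact hu _ _
    refine (Finset.sum_le_sum (fun b _ => step1 b)).trans ?_
    rw [Finset.sum_comm, Finset.sum_comm (f := fun (b : Bool) (s : Fin n → Bool) => _)]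
    apply Finset.sum_le_sum
    intro s _
    simp only [Fintype.sum_bool, rsign]
    simp only [if_true, one_mul, Bool.false_eq_true, if_false]
    have hM : 0 ≤ M := by
      obtain ⟨i⟩ := ‹Nonempty ι›
      exact (abs_nonneg _).trans (hu i 0)
    have hA : 0 ≤ A := by
      obtain ⟨i⟩ := ‹Nonempty ι›
      exact (abs_nonneg _).trans (ha i)
    have hcb : ∀ i, |a i + ∑ m, rsign (s m) * u i m.succ| ≤ A + n * M + M := by
      intro i
      have h1 : |∑ m, rsign (s m) * u i m.succ| ≤ n * M := by
        refine (Finset.abs_sum_le_sum_abs _ _).trans ?_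
        refine (Finset.sum_le_card_nsmul _ _ M ?_).trans ?_
        · intro m _; rw [abs_mul, sml_rsign_abs, one_mul]; exact hu _ _
        · simp
      exact (abs_add_le _ _).trans (by linarith [ha i])
    have := sml_two_point (fun i => a i + ∑ m, rsign (s m) * u i m.succ) (fun i => u i 0) (φ 0)
      (hφ 0) (A + n * M + M) hcb (fun i => (hu i 0).trans (by
        have : 0 ≤ (n:ℝ) * M := by positivity
        linarith))
    simp only [rsign] at this
    convert this using 2 <;> (congr 1 <;> (ext i; ring))

lemma sml_abs_iSup_le {ι : Type*} [Nonempty ι] {h : ι → ℝ} {C : ℝ} (hb : ∀ i, |h i| ≤ C) :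
    |⨆ i, h i| ≤ C := by
  have b : BddAbove (Set.range h) := ⟨C, by rintro _ ⟨i, rfl⟩; exact (abs_le.1 (hb i)).2⟩
  obtain ⟨i⟩ := ‹Nonempty ι›
  have : Nonempty ι := ⟨i⟩
  rw [abs_le]
  exact ⟨(abs_le.1 (hb i)).1.trans (le_ciSup b i), ciSup_le (fun j => (abs_le.1 (hb j)).2)⟩

lemma sml_bdd {ι : Type*} {h : ι → ℝ} (C : ℝ) (hb : ∀ i, |h i| ≤ C) : BddAbove (Set.range h) :=
  ⟨C, by rintro _ ⟨i, rfl⟩; exact (abs_le.1 (hb i)).2⟩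

lemma sml_mean_le (n : ℕ) (hn : 0 < n) (u : Fin n → ℝ) (C : ℝ) (hu : ∀ m, |u m| ≤ C) :
    |((1 : ℝ) / n) * ∑ m, u m| ≤ C := by
  have hn' : (0 : ℝ) < n := by exact_mod_cast hn
  have h1 : |∑ m, u m| ≤ n * C := by
    refine (Finset.abs_sum_le_sum_abs _ _).trans ?_
    refine (Finset.sum_le_card_nsmul _ _ C ?_).trans ?_
    · intro m _; exact hu _
    · simp
  rw [abs_mul, abs_of_pos (by positivity)]
  calc 1 / (n:ℝ) * |∑ m, u m| ≤ 1 / (n:ℝ) * (n * C) := by gcongr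
    _ = C := by field_simp

lemma sml_mp_int {X Y : Type*} [MeasurableSpace X] [MeasurableSpace Y] {μ : Measure X}
    {ν : Measure Y} {T : X → Y} (hT : MeasurePreserving T μ ν) {g : Y → ℝ} (hg : Measurable g) :
    ∫ x, g (T x) ∂μ = ∫ y, g y ∂ν := by
  rw [← hT.map_eq, integral_map hT.measurable.aemeasurable hg.aestronglyMeasurable]

lemma sml_symm {X : Type*} [MeasurableSpace X] (ν : Measure X) [IsProbabilityMeasure ν]
    {ι : Type*} [Countable ι] [Nonempty ι] (G : ι → X → ℝ) (hG : ∀ i, Measurable (G i))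
    (M : ℝ) (hb : ∀ i x, |G i x| ≤ M) (n : ℕ) (hn : 0 < n) :
    ∫ ω, (⨆ i, ((∫ x, G i x ∂ν) - ((1 : ℝ) / n) * ∑ m, G i (ω m))) ∂(Measure.pi fun _ : Fin n => ν)
    ≤ 2 * ∫ ω, (∑ s : Fin n → Bool, ⨆ i, ((1 : ℝ) / n) * ∑ m, rsign (s m) * G i (ω m)) / 2 ^ n
        ∂(Measure.pi fun _ : Fin n => ν) := by
  set P := Measure.pi fun _ : Fin n => ν with hP
  set Q := Measure.pi fun _ : Fin n => ν.prod ν with hQ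
  have hn' : (0 : ℝ) < n := by exact_mod_cast hn
  let S : (Fin n → Bool) → (Fin n → X) → ℝ := fun s ω =>
    ⨆ i, ((1 : ℝ) / n) * ∑ m, rsign (s m) * G i (ω m)
  let T : (Fin n → Bool) → (Fin n → X × X) → ℝ := fun s p =>
    ⨆ i, ((1 : ℝ) / n) * ∑ m, rsign (s m) * (G i (p m).2 - G i (p m).1)
  let U : (Fin n → X) × (Fin n → X) → ℝ := fun p =>
    ⨆ i, ((1 : ℝ) / n) * ∑ m, (G i (p.2 m) - G i (p.1 m))
  have hdb : ∀ i x y, |G i x - G i y| ≤ 2 * M := fun i x y =>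
    (abs_sub _ _).trans (by linarith [hb i x, hb i y])
  have hSb : ∀ (s : Fin n → Bool) (ω : Fin n → X) i, |((1 : ℝ) / n) * ∑ m, rsign (s m) * G i (ω m)| ≤ M := fun s ω i =>
    sml_mean_le n hn _ M (fun m => by rw [abs_mul, sml_rsign_abs, one_mul]; exact hb _ _)
  have hUb : ∀ (p : (Fin n → X) × (Fin n → X)) i,
      |((1 : ℝ) / n) * ∑ m, (G i (p.2 m) - G i (p.1 m))| ≤ 2 * M := fun p i =>
    sml_mean_le n hn _ _ (fun m => hdb _ _ _)
  have hTb : ∀ (s : Fin n → Bool) (p : Fin n → X × X) i,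
      |((1 : ℝ) / n) * ∑ m, rsign (s m) * (G i (p m).2 - G i (p m).1)| ≤ 2 * M := fun s p i =>
    sml_mean_le n hn _ _ (fun m => by rw [abs_mul, sml_rsign_abs, one_mul]; exact hdb _ _ _)
  have hSm : ∀ s, Measurable (S s) := fun s => by
    refine Measurable.iSup (fun i => ?_)
    have := hG i
    fun_prop
  have hTm : ∀ s, Measurable (T s) := fun s => by
    refine Measurable.iSup (fun i => ?_)
    have := hG i
    fun_prop
  have hUm : Measurable U := by
    refine Measurable.iSup (fun i => ?_)
    have := hG i
    fun_prop
  have hSi : ∀ s, Integrable (S s) P := fun s =>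
    sml_int_bdd _ (hSm s) M (fun ω => sml_abs_iSup_le (hSb s ω))
  have hTi : ∀ s, Integrable (T s) Q := fun s =>
    sml_int_bdd _ (hTm s) (2 * M) (fun ω => sml_abs_iSup_le (hTb s ω))
  have hUi : Integrable U (P.prod P) :=
    sml_int_bdd _ hUm (2 * M) (fun ω => sml_abs_iSup_le (hUb ω))
  -- ghost sample
  have ha : ∀ ω, (⨆ i, ((∫ x, G i x ∂ν) - ((1 : ℝ) / n) * ∑ m, G i (ω m)))
      ≤ ∫ ω', U (ω, ω') ∂P := by
    intro ω
    apply ciSup_le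
    intro i
    have hGi : ∀ m, Integrable (fun ω' : Fin n → X => G i (ω' m) - G i (ω m)) P := fun m =>
      sml_int_bdd _ (((hG i).comp (measurable_pi_apply m)).sub_const _) (2 * M)
        (fun ω' => hdb _ _ _)
    have he : ∀ m, ∫ ω', (G i (ω' m) - G i (ω m)) ∂P = (∫ x, G i x ∂ν) - G i (ω m) := by
      intro m
      have hi : Integrable (fun ω' : Fin n → X => G i (ω' m)) P :=
        sml_int_bdd _ ((hG i).comp (measurable_pi_apply m)) M (fun _ => hb _ _)
      rw [integral_sub hi (integrable_const _)]
      have := sml_mp_int (measurePreserving_eval (fun _ : Fin n => ν) m) (hG i)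
      simp only [Function.eval] at this
      rw [this]
      simp
    have h1 : ∫ ω', ((1 : ℝ) / n) * ∑ m, (G i (ω' m) - G i (ω m)) ∂P
        = (∫ x, G i x ∂ν) - ((1 : ℝ) / n) * ∑ m, G i (ω m) := by
      rw [integral_const_mul, integral_finsetSum _ (fun m _ => hGi m)]
      simp only [he, Finset.sum_sub_distrib, Finset.sum_const, Finset.card_univ, Fintype.card_fin,
        nsmul_eq_mul]
      field_simp
    rw [← h1]
    apply integral_mono
    · exact (integrable_finsetSum _ (fun m _ => hGi m)).const_mul _
    · exact sml_int_bdd _ (hUm.comp measurable_prodMk_left) (2 * M)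
        (fun ω' => sml_abs_iSup_le (hUb _))
    · intro ω'
      exact le_ciSup (sml_bdd _ (hUb (ω, ω'))) i
  have hDm : Measurable (fun ω : Fin n → X =>
      ⨆ i, ((∫ x, G i x ∂ν) - ((1 : ℝ) / n) * ∑ m, G i (ω m))) := by
    refine Measurable.iSup (fun i => ?_)
    have := hG i
    fun_prop
  have hDi : Integrable (fun ω : Fin n → X =>
      ⨆ i, ((∫ x, G i x ∂ν) - ((1 : ℝ) / n) * ∑ m, G i (ω m))) P := by
    refine sml_int_bdd _ hDm (2 * M) (fun ω => sml_abs_iSup_le (fun i => ?_))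
    have h1 := sml_abs_integral_le ν M (hb i)
    have h2 := sml_mean_le n hn (fun m => G i (ω m)) M (fun m => hb _ _)
    exact (abs_sub _ _).trans (by linarith)
  have hb1 : ∫ ω, (⨆ i, ((∫ x, G i x ∂ν) - ((1 : ℝ) / n) * ∑ m, G i (ω m))) ∂P
      ≤ ∫ p, U p ∂(P.prod P) := by
    rw [integral_prod _ hUi]
    exact integral_mono hDi hUi.integral_prod_left ha
  have hb2 : ∫ p, U p ∂(P.prod P) = ∫ p, T (fun _ => true) p ∂Q := by
    rw [← sml_mp_int (measurePreserving_arrowProdEquivProdArrow X X (Fin n) (fun _ => ν)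
      (fun _ => ν)) hUm]
    congr 1
    ext p
    simp [U, T, rsign, MeasurableEquiv.arrowProdEquivProdArrow, Equiv.arrowProdEquivProdArrow]
  have hc : ∀ s, ∫ p, T s p ∂Q = ∫ p, T (fun _ => true) p ∂Q := by
    intro s
    have hmp : ∀ m : Fin n, MeasurePreserving (fun z : X × X => if s m then z else z.swap)
        (ν.prod ν) (ν.prod ν) := by
      intro m
      cases s m
      · simpa using Measure.measurePreserving_swap (μ := ν) (ν := ν)
      · simp only [if_true]
        exact MeasurePreserving.id (ν.prod ν)
    rw [← sml_mp_int (measurePreserving_pi _ _ hmp) (hTm (fun _ => true))]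
    congr 1
    ext p
    simp only [T]
    congr 1
    ext i
    congr 2
    ext m
    cases h : s m <;> simp [rsign]
  let neg : (Fin n → Bool) → (Fin n → Bool) := fun s m => !(s m)
  have hneg : Function.Involutive neg := fun s => by ext m; simp [neg]
  have hd : ∀ s, ∫ p, T s p ∂Q ≤ ∫ ω, S s ω ∂P + ∫ ω, S (neg s) ω ∂P := by
    intro s
    have m1 : MeasurePreserving (fun (p : Fin n → X × X) m => (p m).2) Q P :=
      measurePreserving_pi _ _ (fun _ => measurePreserving_snd)
    have m2 : MeasurePreserving (fun (p : Fin n → X × X) m => (p m).1) Q P :=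
      measurePreserving_pi _ _ (fun _ => measurePreserving_fst)
    rw [← sml_mp_int m1 (hSm s), ← sml_mp_int m2 (hSm (neg s))]
    have i1 : Integrable (fun p : Fin n → X × X => S s (fun m => (p m).2)) Q :=
      m1.integrable_comp_of_integrable (hSi s)
    have i2 : Integrable (fun p : Fin n → X × X => S (neg s) (fun m => (p m).1)) Q :=
      m2.integrable_comp_of_integrable (hSi (neg s))
    rw [← integral_add i1 i2]
    apply integral_mono (hTi s) (i1.add i2)
    intro p
    apply ciSup_le
    intro i
    have h1 := le_ciSup (sml_bdd _ (hSb s (fun m => (p m).2))) i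
    have h2 := le_ciSup (sml_bdd _ (hSb (neg s) (fun m => (p m).1))) i
    refine le_trans (le_of_eq ?_) (add_le_add h1 h2)
    rw [← mul_add, ← Finset.sum_add_distrib]
    congr 2
    ext m
    cases h : s m <;> simp [rsign, neg, h] <;> ring
  have hsum := Finset.sum_le_sum (fun s (_ : s ∈ Finset.univ) => hd s)
  simp only [hc, Finset.sum_const, Finset.card_univ, nsmul_eq_mul, Finset.sum_add_distrib] at hsum
  have hre : ∑ s, ∫ ω, S (neg s) ω ∂P = ∑ s, ∫ ω, S s ω ∂P :=
    Equiv.sum_comp (hneg.toPerm) (fun s => ∫ ω, S s ω ∂P)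
  rw [hre] at hsum
  simp at hsum
  have hfin : ∫ ω, (∑ s : Fin n → Bool, ⨆ i, ((1 : ℝ) / n) * ∑ m, rsign (s m) * G i (ω m)) / 2 ^ n
      ∂P = (∑ s, ∫ ω, S s ω ∂P) / 2 ^ n := by
    rw [integral_div, integral_finsetSum _ (fun s _ => hSi s)]
  rw [hfin]
  refine hb1.trans ?_
  rw [hb2, ← mul_div_assoc, le_div_iff₀ (by positivity)]
  linarith

/-- Uniform one-sided deviation bound for a Lipschitz transform of the class. -/
lemma sml_dev {X : Type*} [MeasurableSpace X] (ν : Measure X) [IsProbabilityMeasure ν]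
    {ι : Type*} [Countable ι] [Nonempty ι] (F : ι → X → ℝ) (hF : ∀ i, Measurable (F i))
    (B : ℝ) (hB : 0 < B) (hFb : ∀ i x, |F i x| ≤ B)
    (φ : X → ℝ → ℝ) (hφ : ∀ z x y, |φ z x - φ z y| ≤ |x - y|)
    (hG : ∀ i, Measurable (fun z => φ z (F i z))) (hb : ∀ i z, |φ z (F i z)| ≤ B)
    (n : ℕ) (hn : 0 < n) (ρ : ℝ)
    (hρ : ρ = 2 * ∫ ω, (∑ s : Fin n → Bool,
        |⨆ i, ((1 : ℝ) / n) * ∑ m, rsign (s m) * F i (ω m)|) / 2 ^ n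
        ∂(Measure.pi fun _ : Fin n => ν)) (d : ℝ) (hd : ρ ≤ d) :
    (Measure.pi fun _ : Fin n => ν).real
      {ω | d ≤ ⨆ i, ((∫ x, φ x (F i x) ∂ν) - ((1 : ℝ) / n) * ∑ m, φ (ω m) (F i (ω m)))}
      ≤ Real.exp (-((d - ρ) ^ 2 * (n : ℝ)) / (2 * B ^ 2)) := by
  have hn' : (0 : ℝ) < n := by exact_mod_cast hn
  have hDb : ∀ (ω : Fin n → X) i,
      |(∫ x, φ x (F i x) ∂ν) - ((1 : ℝ) / n) * ∑ m, φ (ω m) (F i (ω m))| ≤ 2 * B := by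
    intro ω i
    have h1 := sml_abs_integral_le ν B (hb i)
    have h2 := sml_mean_le n hn (fun m => φ (ω m) (F i (ω m))) B (fun m => hb _ _)
    exact (abs_sub _ _).trans (by linarith)
  apply sml_mcd_tail ν B hB (2 * B) n hn
  · refine Measurable.iSup (fun i => ?_)
    refine Measurable.const_sub ?_ _
    refine Measurable.const_mul ?_ _
    exact Finset.measurable_fun_sum _ (fun m _ => (hG i).comp (measurable_pi_apply m))
  · intro ω
    exact sml_abs_iSup_le (hDb ω)
  · intro x y m hxy
    rw [sub_le_iff_le_add]
    apply ciSup_le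
    intro i
    have h1 := le_ciSup (sml_bdd _ (hDb y)) i
    have h2 : ∑ j, φ (y j) (F i (y j)) - ∑ j, φ (x j) (F i (x j)) ≤ 2 * B := by
      rw [← Finset.sum_sub_distrib, Finset.sum_eq_single m]
      · have := abs_le.1 (hb i (y m))
        have := abs_le.1 (hb i (x m))
        linarith
      · intro j _ hj
        rw [hxy j hj, sub_self]
      · simp
    have h3 : ((1 : ℝ) / n) * (∑ j, φ (y j) (F i (y j)) - ∑ j, φ (x j) (F i (x j)))
        ≤ 2 * B / n := by
      rw [one_div, inv_mul_eq_div]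
      gcongr
    rw [mul_sub] at h3
    linarith
  · refine (sml_symm ν (fun i z => φ z (F i z)) hG B hb n hn).trans ?_
    rw [hρ]
    have hsb : ∀ (s : Fin n → Bool) (ω : Fin n → X) i,
        |((1 : ℝ) / n) * ∑ m, rsign (s m) * F i (ω m)| ≤ B := fun s ω i =>
      sml_mean_le n hn _ B (fun m => by rw [abs_mul, sml_rsign_abs, one_mul]; exact hFb _ _)
    have hsb2 : ∀ (s : Fin n → Bool) (ω : Fin n → X) i,
        |((1 : ℝ) / n) * ∑ m, rsign (s m) * φ (ω m) (F i (ω m))| ≤ B := fun s ω i =>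
      sml_mean_le n hn _ B (fun m => by rw [abs_mul, sml_rsign_abs, one_mul]; exact hb _ _)
    gcongr 2 * ?_
    apply integral_mono
    · refine Integrable.div_const (integrable_finsetSum _ (fun s _ => ?_)) _
      refine sml_int_bdd _ ?_ B (fun ω => sml_abs_iSup_le (hsb2 s ω))
      refine Measurable.iSup (fun i => ?_)
      refine Measurable.const_mul ?_ _
      exact Finset.measurable_fun_sum _
        (fun m _ => ((hG i).comp (measurable_pi_apply m)).const_mul _)
    · refine Integrable.div_const (integrable_finsetSum _ (fun s _ => ?_)) _
      refine Integrable.abs ?_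
      refine sml_int_bdd _ ?_ B (fun ω => sml_abs_iSup_le (hsb s ω))
      refine Measurable.iSup (fun i => ?_)
      have := hF i
      fun_prop
    · intro ω
      have hc := sml_contraction (ι := ι) B n (fun _ => 0) 0 (by simp) (fun m => φ (ω m))
        (fun m => hφ _) (fun i m => F i (ω m)) (fun i m => hFb _ _)
      simp only [zero_add] at hc
      simp only
      gcongr ?_ / _
      simp only [← Real.mul_iSup_of_nonneg (show (0:ℝ) ≤ 1 / n by positivity), ← Finset.mul_sum]
      refine (mul_le_mul_of_nonneg_left hc (by positivity)).trans ?_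
      rw [Finset.mul_sum]
      exact Finset.sum_le_sum (fun s _ => le_abs_self _)
  · exact hd

lemma sml_log_lip_aux {x y : ℝ} (h : y ≤ x) :
    0 ≤ Real.log (1 + Real.exp x) - Real.log (1 + Real.exp y) ∧
    Real.log (1 + Real.exp x) - Real.log (1 + Real.exp y) ≤ x - y := by
  constructor
  · rw [sub_nonneg]
    gcongr
  · rw [sub_le_iff_le_add]
    have h1 : Real.log (1 + Real.exp x) ≤ Real.log (Real.exp (x - y) * (1 + Real.exp y)) := by
      apply Real.log_le_log (by positivity)
      rw [mul_add, ← Real.exp_add, mul_one, sub_add_cancel]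
      have : 1 ≤ Real.exp (x - y) := Real.one_le_exp (by linarith)
      linarith
    rwa [Real.log_mul (by positivity) (by positivity), Real.log_exp] at h1

lemma sml_log_lip (x y : ℝ) :
    |Real.log (1 + Real.exp x) - Real.log (1 + Real.exp y)| ≤ |x - y| := by
  rcases le_total y x with h | h
  · have := sml_log_lip_aux h
    rw [abs_of_nonneg this.1, abs_of_nonneg (by linarith)]
    exact this.2
  · have := sml_log_lip_aux h
    rw [abs_sub_comm, abs_sub_comm x, abs_of_nonneg this.1, abs_of_nonneg (by linarith)]
    exact this.2

lemma sml_log_range (B x y : ℝ) (hx : |x| ≤ B) (hy : |y| ≤ B) :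
    |Real.log (1 + Real.exp x) - Real.log (1 + Real.exp y)| ≤ B := by
  have hx' := abs_le.1 hx
  have hy' := abs_le.1 hy
  have h1 := (sml_log_lip_aux hx'.2).1
  have h2 := (sml_log_lip_aux hy'.2).1
  have h3 := (sml_log_lip_aux hx'.1).1
  have h4 := (sml_log_lip_aux hy'.1).1
  have h5 : Real.log (1 + Real.exp B) = B + Real.log (1 + Real.exp (-B)) := by
    have : 1 + Real.exp B = Real.exp B * (1 + Real.exp (-B)) := by
      rw [mul_add, ← Real.exp_add]; simp; ring
    rw [this, Real.log_mul (by positivity) (by positivity), Real.log_exp]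
  rw [abs_le]
  constructor <;> linarith

lemma sml_tangent (d : ℝ) : ∃ σ : ℝ, 0 < σ ∧ ∀ u,
    Real.log (1 + Real.exp (-d)) + σ * (u + d) ≤ Real.log (1 + Real.exp u) := by
  refine ⟨Real.exp (-d) / (1 + Real.exp (-d)), by positivity, fun u => ?_⟩
  have hpos : 0 < 1 + Real.exp (-d) := by positivity
  set σ := Real.exp (-d) / (1 + Real.exp (-d)) with hσ
  have hσ1 : 1 - σ = 1 / (1 + Real.exp (-d)) := by rw [hσ]; field_simp; ring
  have hc := convexOn_exp.2 (Set.mem_univ (0:ℝ)) (Set.mem_univ (u + d))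
    (show 0 ≤ 1 - σ by rw [hσ1]; positivity) (show 0 ≤ σ by positivity) (by ring)
  simp only [smul_eq_mul, mul_zero, zero_add, Real.exp_zero, mul_one] at hc
  have h2 : (1 + Real.exp (-d)) * (1 - σ + σ * Real.exp (u + d)) = 1 + Real.exp u := by
    rw [hσ1, hσ]
    have : Real.exp (-d) * Real.exp (u + d) = Real.exp u := by
      rw [← Real.exp_add]; congr 1; ring
    field_simp
    linarith
  rw [← h2, Real.log_mul (by positivity) (by
    have : 0 < 1 - σ := by rw [hσ1]; positivity
    positivity)]
  have h3 : σ * (u + d) ≤ Real.log (1 - σ + σ * Real.exp (u + d)) := by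
    have := Real.log_le_log (Real.exp_pos _) hc
    rwa [Real.log_exp] at this
  linarith

lemma sml_int_mix {X : Type*} [MeasurableSpace X] (Lp Lm : Measure X) [IsProbabilityMeasure Lp]
    [IsProbabilityMeasure Lm] (ν : Measure (X × Bool))
    (hν : ν = (1/2 : ENNReal) • Lp.map (fun x => (x, true))
        + (1/2 : ENNReal) • Lm.map (fun x => (x, false)))
    (g : X × Bool → ℝ) (hg : Measurable g) (C : ℝ) (hb : ∀ z, |g z| ≤ C) :
    ∫ z, g z ∂ν = (1/2) * (∫ x, g (x, true) ∂Lp) + (1/2) * (∫ x, g (x, false) ∂Lm) := by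
  have m1 : Measurable (fun x : X => (x, true)) := by fun_prop
  have m2 : Measurable (fun x : X => (x, false)) := by fun_prop
  have : IsProbabilityMeasure (Lp.map (fun x => (x, true))) :=
    Measure.isProbabilityMeasure_map m1.aemeasurable
  have : IsProbabilityMeasure (Lm.map (fun x => (x, false))) :=
    Measure.isProbabilityMeasure_map m2.aemeasurable
  rw [hν, integral_add_measure, integral_smul_measure, integral_smul_measure,
    integral_map m1.aemeasurable hg.aestronglyMeasurable,
    integral_map m2.aemeasurable hg.aestronglyMeasurable]
  · simp
  · exact (sml_int_bdd _ hg C hb).smul_measure (by simp)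
  · exact (sml_int_bdd _ hg C hb).smul_measure (by simp)

lemma sml_rsign_meas : Measurable rsign := measurable_from_top

/-- SML consistency.  There are `K` agents.  Agent `k` has class-conditional
likelihoods `Lp k, Lm k` on its feature space `H k`, a countable uniformly bounded
(by `B > 0`) class of measurable logit functions `F k i : H k → ℝ` (indexed by `ι k`),
logistic risk `Rk`, target model `fo k` minimizing `Rk k`, and `N k` i.i.d. training pairs
(features paired with a uniform `±1` label, label encoded by `Bool`, joint law `ν k`),
independent across agents (global product law `P` on `Ω = Π k, Fin (N k) → H k × Bool`).
`Remp` is the empirical logistic risk, `ftil k` a measurable empirical risk minimizer,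
`ρ k = ρ_N^{(k)}` twice the expected empirical Rademacher average of agent `k`'s class
over its training features, `Rfo = Σ_k π_k R_k(f_k^o) < log 2`, and the Rademacher
expectation over signs is written as the average over all sign patterns `s`.
For any `d` with `0 < d < −log(e^{Rfo} − 1)`, setting `Δ = log(1 + e^{−d})` and assuming
`ρ_N^{(k)} < d` and `ρ_N^{(k)} < (Δ − Rfo)/2` for every `k`, the probability that
simultaneously `μ⁺(f̃^N) > μ̃^N(f̃^N)` and `μ⁻(f̃^N) < μ̃^N(f̃^N)` is at least
`1 − 2 Σ_k exp(−(d − ρ_N^{(k)})² N_k/(2B²)) − Σ_k exp(−((Δ−Rfo)/2 − ρ_N^{(k)})² N_k/(2B²))`. -/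
theorem sml_consistency
    {K : ℕ} (hK : 0 < K)
    (H : Fin K → Type*) [∀ k, MeasurableSpace (H k)]
    (Lp Lm : ∀ k, Measure (H k))
    [∀ k, IsProbabilityMeasure (Lp k)] [∀ k, IsProbabilityMeasure (Lm k)]
    (ι : Fin K → Type*) [∀ k, Countable (ι k)] [∀ k, Nonempty (ι k)]
    [∀ k, MeasurableSpace (ι k)]
    (F : ∀ k, ι k → H k → ℝ) (hFmeas : ∀ k i, Measurable (F k i))
    (B : ℝ) (hB : 0 < B) (hFb : ∀ k i x, |F k i x| ≤ B)
    (Rk : ∀ k, ι k → ℝ)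
    (hRk : ∀ k i, Rk k i = (1/2) * (∫ x, Real.log (1 + Real.exp (-(F k i x))) ∂(Lp k))
        + (1/2) * (∫ x, Real.log (1 + Real.exp (F k i x)) ∂(Lm k)))
    (fo : ∀ k, ι k) (hfo : ∀ k i, Rk k (fo k) ≤ Rk k i)
    (π : Fin K → ℝ) (hπ : ∀ k, 0 < π k) (hπs : ∑ k, π k = 1)
    (Rfo : ℝ) (hRfo : Rfo = ∑ k, π k * Rk k (fo k)) (hRlt : Rfo < Real.log 2)
    (N : Fin K → ℕ) (hN : ∀ k, 0 < N k)
    (ν : ∀ k, Measure (H k × Bool)) [∀ k, IsProbabilityMeasure (ν k)]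
    (hν : ∀ k, ν k = (1/2 : ENNReal) • (Lp k).map (fun x => (x, true))
        + (1/2 : ENNReal) • (Lm k).map (fun x => (x, false)))
    (Remp : ∀ k, ι k → (Fin (N k) → H k × Bool) → ℝ)
    (hRemp : ∀ k i ω, Remp k i ω = ((1 : ℝ) / (N k)) *
        ∑ m, Real.log (1 + Real.exp (-(rsign (ω m).2 * F k i (ω m).1))))
    (ftil : ∀ k, (Fin (N k) → H k × Bool) → ι k)
    (hftilmeas : ∀ k, Measurable (ftil k))
    (hftilmin : ∀ k ω i, Remp k (ftil k ω) ω ≤ Remp k i ω)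
    (ρ : Fin K → ℝ)
    (hρ : ∀ k, ρ k = 2 * ∫ ω, (∑ s : Fin (N k) → Bool,
        |⨆ i, ((1 : ℝ) / (N k)) * ∑ m, rsign (s m) * F k i ((ω m).1)|) / 2 ^ (N k)
        ∂(Measure.pi fun _ : Fin (N k) => ν k))
    (d : ℝ) (hd0 : 0 < d) (hd1 : d < -Real.log (Real.exp Rfo - 1))
    (Δ : ℝ) (hΔ : Δ = Real.log (1 + Real.exp (-d)))
    (hρd : ∀ k, ρ k < d) (hρΔ : ∀ k, ρ k < (Δ - Rfo) / 2) :
    1 - 2 * (∑ k, Real.exp (-((d - ρ k) ^ 2 * (N k : ℝ)) / (2 * B ^ 2)))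
      - ∑ k, Real.exp (-(((Δ - Rfo) / 2 - ρ k) ^ 2 * (N k : ℝ)) / (2 * B ^ 2))
    ≤ ((Measure.pi fun k => Measure.pi fun _ : Fin (N k) => ν k)
        {ω : ∀ k, Fin (N k) → H k × Bool |
          (∑ k, π k * ∫ x, F k (ftil k (ω k)) x ∂(Lp k)) >
              (∑ k, π k * (((1 : ℝ) / (N k)) * ∑ m, F k (ftil k (ω k)) ((ω k m).1)))
          ∧ (∑ k, π k * ∫ x, F k (ftil k (ω k)) x ∂(Lm k)) <
              (∑ k, π k * (((1 : ℝ) / (N k)) * ∑ m, F k (ftil k (ω k)) ((ω k m).1)))}).toReal := by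
  classical
  set a := (Δ - Rfo) / 2 with ha
  have hρ0 : ∀ k, 0 ≤ ρ k := by
    intro k
    rw [hρ k]
    have : 0 ≤ ∫ ω, (∑ s : Fin (N k) → Bool,
        |⨆ i, ((1 : ℝ) / (N k)) * ∑ m, rsign (s m) * F k i ((ω m).1)|) / 2 ^ (N k)
        ∂(Measure.pi fun _ : Fin (N k) => ν k) := integral_nonneg (fun ω => by positivity)
    positivity
  have ha0 : 0 < a := (hρ0 ⟨0, hK⟩).trans_lt (hρΔ _)
  -- the class on the product space
  let G : ∀ k, ι k → H k × Bool → ℝ := fun k i z => F k i z.1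
  have hGm : ∀ k i, Measurable (G k i) := fun k i => (hFmeas k i).comp measurable_fst
  have hGb : ∀ k i z, |G k i z| ≤ B := fun k i z => hFb k i z.1
  let ℓ : ∀ k, ι k → H k × Bool → ℝ := fun k i z =>
    Real.log (1 + Real.exp (-(rsign z.2 * F k i z.1)))
  let φ : ∀ k, H k × Bool → ℝ → ℝ := fun k z u =>
    Real.log (1 + Real.exp (-(rsign z.2 * u))) - ℓ k (fo k) z
  have hrs : ∀ (b : Bool) (u : ℝ), |-(rsign b * u)| = |u| := fun b u => by
    rw [abs_neg, abs_mul, sml_rsign_abs, one_mul]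
  have hℓm : ∀ k i, Measurable (ℓ k i) := by
    intro k i
    have h1 : Measurable (fun z : H k × Bool => rsign z.2) := sml_rsign_meas.comp measurable_snd
    have h2 := hGm k i
    exact Real.measurable_log.comp ((Real.measurable_exp.comp (h1.mul h2).neg).const_add 1)
  have hφb : ∀ k i z, |φ k z (G k i z)| ≤ B := by
    intro k i z
    apply sml_log_range
    · rw [hrs]; exact hFb _ _ _
    · rw [hrs]; exact hFb _ _ _
  have hφl : ∀ k z x y, |φ k z x - φ k z y| ≤ |x - y| := by
    intro k z x y
    simp only [φ, sub_sub_sub_cancel_right]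
    refine (sml_log_lip _ _).trans (le_of_eq ?_)
    rw [← hrs z.2 (x - y)]
    congr 1
    ring
  have hφm : ∀ k i, Measurable (fun z => φ k z (G k i z)) := fun k i =>
    (hℓm k i).sub (hℓm k (fo k))
  let P : ∀ k, Measure (Fin (N k) → H k × Bool) := fun k => Measure.pi fun _ : Fin (N k) => ν k
  let S1 : ∀ k, Set (Fin (N k) → H k × Bool) := fun k => {ω | d ≤ ⨆ i,
    ((∫ x, G k i x ∂(ν k)) - ((1 : ℝ) / (N k)) * ∑ m, G k i (ω m))}
  let S2 : ∀ k, Set (Fin (N k) → H k × Bool) := fun k => {ω | d ≤ ⨆ i,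
    ((∫ x, -(G k i x) ∂(ν k)) - ((1 : ℝ) / (N k)) * ∑ m, -(G k i (ω m)))}
  let S3 : ∀ k, Set (Fin (N k) → H k × Bool) := fun k => {ω | a ≤ ⨆ i,
    ((∫ x, φ k x (G k i x) ∂(ν k)) - ((1 : ℝ) / (N k)) * ∑ m, φ k (ω m) (G k i (ω m)))}
  have hS1 : ∀ k, (P k).real (S1 k) ≤ Real.exp (-((d - ρ k) ^ 2 * (N k : ℝ)) / (2 * B ^ 2)) :=
    fun k => sml_dev (ν k) (G k) (hGm k) B hB (hGb k) (fun _ u => u) (fun _ _ _ => le_rfl)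
      (hGm k) (hGb k) (N k) (hN k) (ρ k) (hρ k) d (hρd k).le
  have hS2 : ∀ k, (P k).real (S2 k) ≤ Real.exp (-((d - ρ k) ^ 2 * (N k : ℝ)) / (2 * B ^ 2)) :=
    fun k => sml_dev (ν k) (G k) (hGm k) B hB (hGb k) (fun _ u => -u)
      (fun _ x y => by rw [← abs_neg]; apply le_of_eq; congr 1; ring)
      (fun i => (hGm k i).neg) (fun i z => by rw [abs_neg]; exact hGb k i z)
      (N k) (hN k) (ρ k) (hρ k) d (hρd k).le
  have hS3 : ∀ k, (P k).real (S3 k) ≤ Real.exp (-((a - ρ k) ^ 2 * (N k : ℝ)) / (2 * B ^ 2)) :=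
    fun k => sml_dev (ν k) (G k) (hGm k) B hB (hGb k) (φ k) (hφl k)
      (hφm k) (hφb k) (N k) (hN k) (ρ k) (hρ k) a (hρΔ k).le
  obtain ⟨σ, hσ, htan⟩ := sml_tangent d
  rw [← hΔ] at htan
  have hmean : ∀ k i, ∫ z, G k i z ∂(ν k)
      = (1/2) * (∫ x, F k i x ∂(Lp k)) + (1/2) * (∫ x, F k i x ∂(Lm k)) := fun k i =>
    sml_int_mix (Lp k) (Lm k) (ν k) (hν k) (G k i) (hGm k i) B (hGb k i)
  have hlogb : ∀ x, |x| ≤ B → |Real.log (1 + Real.exp x)| ≤ Real.log 2 + B := by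
    intro x hx
    have h1 := sml_log_lip x 0
    rw [sub_zero, Real.exp_zero, one_add_one_eq_two] at h1
    have h2 := abs_sub_abs_le_abs_sub (Real.log (1 + Real.exp x)) (Real.log 2)
    rw [abs_of_nonneg (Real.log_nonneg one_le_two)] at h2
    linarith
  have hℓb : ∀ k i z, |ℓ k i z| ≤ Real.log 2 + B := fun k i z =>
    hlogb _ (by rw [hrs]; exact hFb _ _ _)
  have hrisk : ∀ k i, ∫ z, ℓ k i z ∂(ν k) = Rk k i := by
    intro k i
    rw [sml_int_mix (Lp k) (Lm k) (ν k) (hν k) (ℓ k i) (hℓm k i) _ (hℓb k i), hRk]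
    simp [ℓ, rsign]
  have hφint : ∀ k i, ∫ z, φ k z (G k i z) ∂(ν k) = Rk k i - Rk k (fo k) := by
    intro k i
    rw [← hrisk, ← hrisk]
    exact integral_sub (sml_int_bdd _ (hℓm k i) _ (hℓb k i))
      (sml_int_bdd _ (hℓm k (fo k)) _ (hℓb k (fo k)))
  have hFi : ∀ k i (μ : Measure (H k)) [IsProbabilityMeasure μ], Integrable (F k i) μ :=
    fun k i μ _ => sml_int_bdd μ (hFmeas k i) B (hFb k i)
  have hlow : ∀ k i, Δ + σ * (d - ((∫ x, F k i x ∂(Lp k)) - (∫ x, F k i x ∂(Lm k))) / 2)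
      ≤ Rk k i := by
    intro k i
    rw [hRk]
    have hmF := hFmeas k i
    have h1 : Δ + σ * (d - ∫ x, F k i x ∂(Lp k))
        ≤ ∫ x, Real.log (1 + Real.exp (-(F k i x))) ∂(Lp k) := by
      have hi : Integrable (fun x => Δ + σ * (d - F k i x)) (Lp k) :=
        (integrable_const _).add (((integrable_const _).sub (hFi k i _)).const_mul _)
      calc _ = ∫ x, (Δ + σ * (d - F k i x)) ∂(Lp k) := by
            have hi0 : Integrable (fun x => d - F k i x) (Lp k) :=
              (integrable_const _).sub (hFi k i _)
            rw [integral_add (integrable_const _) (hi0.const_mul _), integral_const_mul,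
              integral_sub (integrable_const _) (hFi k i _)]
            simp
        _ ≤ _ := by
            apply integral_mono hi
            · refine sml_int_bdd _ (by fun_prop) (Real.log 2 + B) (fun x => hlogb _ ?_)
              rw [abs_neg]; exact hFb _ _ _
            · intro x
              have := htan (-(F k i x))
              simp only
              linarith
    have h2 : Δ + σ * (d + ∫ x, F k i x ∂(Lm k))
        ≤ ∫ x, Real.log (1 + Real.exp (F k i x)) ∂(Lm k) := by
      have hi : Integrable (fun x => Δ + σ * (d + F k i x)) (Lm k) :=
        (integrable_const _).add (((integrable_const _).add (hFi k i _)).const_mul _)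
      calc _ = ∫ x, (Δ + σ * (d + F k i x)) ∂(Lm k) := by
            have hi0 : Integrable (fun x => d + F k i x) (Lm k) :=
              (integrable_const _).add (hFi k i _)
            rw [integral_add (integrable_const _) (hi0.const_mul _), integral_const_mul,
              integral_add (integrable_const _) (hFi k i _)]
            simp
        _ ≤ _ := by
            apply integral_mono hi
            · exact sml_int_bdd _ (by fun_prop) (Real.log 2 + B) (fun x => hlogb _ (hFb _ _ _))
            · intro x
              have := htan (F k i x)
              simp only
              linarith
    linarith
  -- per-agent deterministic consequence
  have hdet : ∀ k (ω : Fin (N k) → H k × Bool), ω ∉ S1 k → ω ∉ S2 k → ω ∉ S3 k →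
      Δ - a - Rk k (fo k) ≤ σ * ((∫ x, F k (ftil k ω) x ∂(Lp k))
        - ((1 : ℝ) / (N k)) * ∑ m, F k (ftil k ω) ((ω m).1)) ∧
      Δ - a - Rk k (fo k) ≤ σ * (((1 : ℝ) / (N k)) * ∑ m, F k (ftil k ω) ((ω m).1)
        - (∫ x, F k (ftil k ω) x ∂(Lm k))) := by
    intro k ω n1 n2 n3
    have hsupb : ∀ ψ : ι k → H k × Bool → ℝ, (∀ i z, |ψ i z| ≤ B) → ∀ i : ι k,
        |(∫ x, ψ i x ∂(ν k)) - ((1 : ℝ) / (N k)) * ∑ m, ψ i (ω m)| ≤ 2 * B := by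
      intro ψ hψ i
      have h1 := sml_abs_integral_le (ν k) B (hψ i)
      have h2 := sml_mean_le (N k) (hN k) (fun m => ψ i (ω m)) B (fun m => hψ _ _)
      exact (abs_sub _ _).trans (by linarith)
    set i := ftil k ω with hi
    have e1 := (le_ciSup (sml_bdd _ (hsupb (G k) (hGb k))) i).trans_lt (not_le.1 n1)
    have e2 := (le_ciSup (sml_bdd _ (hsupb (fun i z => -(G k i z))
      (fun i z => by rw [abs_neg]; exact hGb k i z))) i).trans_lt (not_le.1 n2)
    have e3 := (le_ciSup (sml_bdd _ (hsupb (fun i z => φ k z (G k i z)) (hφb k))) i).trans_lt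
      (not_le.1 n3)
    simp only [integral_neg, Finset.sum_neg_distrib, hmean] at e1 e2
    simp only [hφint] at e3
    have e4 : ((1 : ℝ) / (N k)) * ∑ m, φ k (ω m) (G k i (ω m)) ≤ 0 := by
      have h1 := hftilmin k ω (fo k)
      rw [hRemp, hRemp, ← hi] at h1
      simp only [φ, G, ℓ, Finset.sum_sub_distrib, mul_sub]
      linarith
    have e5 := hlow k i
    have e6 : σ * ((((∫ x, F k i x ∂(Lp k)) - (∫ x, F k i x ∂(Lm k))) / 2) - d)
        ≥ Δ - a - Rk k (fo k) := by linarith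
    simp only [G] at e1 e2
    constructor
    · refine e6.le.trans ?_
      apply mul_le_mul_of_nonneg_left _ hσ.le
      linarith
    · refine e6.le.trans ?_
      apply mul_le_mul_of_nonneg_left _ hσ.le
      linarith
  have hsumc : ∑ k, π k * (Δ - a - Rk k (fo k)) = a := by
    have h1 : ∀ k, π k * (Δ - a - Rk k (fo k)) = π k * (Δ - a) - π k * Rk k (fo k) :=
      fun k => by ring
    simp only [h1, Finset.sum_sub_distrib, ← Finset.sum_mul, hπs, ← hRfo]
    rw [ha]; ring
  set Pm := Measure.pi fun k => Measure.pi fun _ : Fin (N k) => ν k with hPm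
  set E := {ω : ∀ k, Fin (N k) → H k × Bool |
          (∑ k, π k * ∫ x, F k (ftil k (ω k)) x ∂(Lp k)) >
              (∑ k, π k * (((1 : ℝ) / (N k)) * ∑ m, F k (ftil k (ω k)) ((ω k m).1)))
          ∧ (∑ k, π k * ∫ x, F k (ftil k (ω k)) x ∂(Lm k)) <
              (∑ k, π k * (((1 : ℝ) / (N k)) * ∑ m, F k (ftil k (ω k)) ((ω k m).1)))} with hE
  have hcover : (Set.univ : Set (∀ k, Fin (N k) → H k × Bool)) ⊆
      E ∪ ⋃ k, Function.eval k ⁻¹' (S1 k ∪ S2 k ∪ S3 k) := by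
    intro ω _
    by_cases hω : ω ∈ ⋃ k, Function.eval k ⁻¹' (S1 k ∪ S2 k ∪ S3 k)
    · exact Or.inr hω
    · left
      have hω' : ∀ k, ω k ∉ S1 k ∧ ω k ∉ S2 k ∧ ω k ∉ S3 k := by
        intro k
        have h : ω k ∉ S1 k ∪ S2 k ∪ S3 k := fun h => hω (Set.mem_iUnion.2 ⟨k, h⟩)
        exact ⟨fun h' => h (Or.inl (Or.inl h')), fun h' => h (Or.inl (Or.inr h')),
          fun h' => h (Or.inr h')⟩
      have hk := fun k => hdet k (ω k) (hω' k).1 (hω' k).2.1 (hω' k).2.2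
      have s1 := Finset.sum_le_sum (fun k (_ : k ∈ Finset.univ) =>
        mul_le_mul_of_nonneg_left (hk k).1 (hπ k).le)
      have s2 := Finset.sum_le_sum (fun k (_ : k ∈ Finset.univ) =>
        mul_le_mul_of_nonneg_left (hk k).2 (hπ k).le)
      rw [hsumc] at s1 s2
      simp only [mul_left_comm (π _) σ, mul_sub (π _)] at s1 s2
      rw [← Finset.mul_sum, Finset.sum_sub_distrib] at s1 s2
      constructor
      · have := (mul_pos_iff_of_pos_left hσ).1 (ha0.trans_le s1)
        exact sub_pos.1 this
      · have := (mul_pos_iff_of_pos_left hσ).1 (ha0.trans_le s2)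
        exact sub_pos.1 this
  have heval : ∀ k, Pm.real (Function.eval k ⁻¹' (S1 k ∪ S2 k ∪ S3 k)) ≤
      2 * Real.exp (-((d - ρ k) ^ 2 * (N k : ℝ)) / (2 * B ^ 2))
      + Real.exp (-((a - ρ k) ^ 2 * (N k : ℝ)) / (2 * B ^ 2)) := by
    intro k
    have mp := measurePreserving_eval P k
    have h1 : Pm.real (Function.eval k ⁻¹' (S1 k ∪ S2 k ∪ S3 k)) ≤ (P k).real (S1 k ∪ S2 k ∪ S3 k) := by
      apply ENNReal.toReal_mono (measure_ne_top _ _)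
      calc _ ≤ (Measure.map (Function.eval k) Pm) (S1 k ∪ S2 k ∪ S3 k) :=
            Measure.le_map_apply mp.measurable.aemeasurable _
        _ = _ := by rw [mp.map_eq]
    have h2 := measureReal_union_le (μ := P k) (S1 k ∪ S2 k) (S3 k)
    have h3 := measureReal_union_le (μ := P k) (S1 k) (S2 k)
    linarith [hS1 k, hS2 k, hS3 k]
  have hfin : 1 ≤ Pm.real E + ∑ k, Pm.real (Function.eval k ⁻¹' (S1 k ∪ S2 k ∪ S3 k)) := by
    calc (1 : ℝ) = Pm.real Set.univ := by simp
      _ ≤ Pm.real (E ∪ ⋃ k, Function.eval k ⁻¹' (S1 k ∪ S2 k ∪ S3 k)) :=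
          measureReal_mono hcover (measure_ne_top _ _)
      _ ≤ _ := (measureReal_union_le _ _).trans (by
          gcongr
          exact measureReal_iUnion_fintype_le _)
  have hsum := Finset.sum_le_sum (fun k (_ : k ∈ Finset.univ) => heval k)
  rw [Finset.sum_add_distrib, ← Finset.mul_sum] at hsum
  change _ ≤ Pm.real E
  linarith
end

section
/- Let μ be a probability measure on a measurable space X, let F be a countable class of measurable functions f : X → ℝ with |f(x)| ≤ B for all x and all f ∈ F (B > 0), and let X_1,…,X_N be i.i.d. with law μ. Set ρ = 2·E[ R(F(X_1^N)) ]. Then for every t > 0, P( sup_{f∈F} | ∫ f dμ − (1/N) Σ_{n=1}^N f(X_n) | ≥ ρ + t ) ≤ 2·exp( −N t² / (2B²) ). -/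
open MeasureTheory

lemma integrable_of_bdd {Ω : Type*} [MeasurableSpace Ω] (P : Measure Ω) [IsProbabilityMeasure P]
    {g : Ω → ℝ} (hg : Measurable g) {C : ℝ} (hC : ∀ ω, |g ω| ≤ C) : Integrable g P :=
  Integrable.of_bound hg.aestronglyMeasurable C (Filter.Eventually.of_forall hC)

lemma abs_integral_le_of_bdd {Ω : Type*} [MeasurableSpace Ω] (P : Measure Ω)
    [IsProbabilityMeasure P]
    {g : Ω → ℝ} {C : ℝ} (hC : ∀ ω, |g ω| ≤ C) : |∫ ω, g ω ∂P| ≤ C := by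
  have := norm_integral_le_of_norm_le_const (μ := P) (f := g) (C := C)
    (Filter.Eventually.of_forall hC)
  simpa using this

lemma integrable_exp_of_bdd {Ω : Type*} [MeasurableSpace Ω] (P : Measure Ω)
    [IsProbabilityMeasure P]
    {g : Ω → ℝ} (hg : Measurable g) {C : ℝ} (hC : ∀ ω, |g ω| ≤ C) (l m : ℝ) :
    Integrable (fun ω => Real.exp (l * (g ω - m))) P := by
  refine integrable_of_bdd P (C := Real.exp (|l| * (C + |m|))) (by fun_prop) fun ω => ?_
  rw [Real.abs_exp]
  refine Real.exp_le_exp.2 ((le_abs_self _).trans ?_)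
  rw [abs_mul]
  gcongr
  exact (abs_sub _ _).trans (by gcongr; exact hC ω)

lemma mcdiarmid_mgf {X : Type*} [MeasurableSpace X] (μ : Measure X) [IsProbabilityMeasure μ]
    (c C : ℝ) (hc : 0 ≤ c) (l : ℝ) (N : ℕ) : ∀ (G : (Fin N → X) → ℝ), Measurable G →
    (∀ ω, |G ω| ≤ C) →
    (∀ n x y, (∀ m, m ≠ n → x m = y m) → G x - G y ≤ c) →
    ∫ ω, Real.exp (l * (G ω - ∫ ω', G ω' ∂(Measure.pi fun _ : Fin N => μ)))
      ∂(Measure.pi fun _ : Fin N => μ) ≤ Real.exp (N * (c / 2) ^ 2 * l ^ 2 / 2) := by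
  induction N with
  | zero =>
    intro G hG hC hd
    have : ∀ ω, G ω = G default := fun ω => congrArg G (Subsingleton.elim _ _)
    simp [this]
  | succ N ih =>
    intro G hG hC hd
    set P := Measure.pi fun _ : Fin N => μ with hP
    have hmp := (measurePreserving_piFinSuccAbove (fun _ : Fin (N+1) => μ) 0).symm
    have heq : ∀ p : X × (Fin N → X),
        (MeasurableEquiv.piFinSuccAbove (fun _ : Fin (N+1) => X) 0).symm p
          = (Fin.cons p.1 p.2 : Fin (N+1) → X) := fun p =>
      Fin.insertNth_zero' p.1 p.2
    have hcons : Measurable fun p : X × (Fin N → X) => (Fin.cons p.1 p.2 : Fin (N+1) → X) := by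
      have := (MeasurableEquiv.piFinSuccAbove (fun _ : Fin (N+1) => X) 0).symm.measurable
      convert this using 1
      exact funext fun p => (heq p).symm
    have key : ∀ h : (Fin (N+1) → X) → ℝ,
        ∫ ω, h ω ∂(Measure.pi fun _ : Fin (N+1) => μ)
          = ∫ p, h (Fin.cons p.1 p.2) ∂(μ.prod P) := by
      intro h
      rw [← hmp.integral_comp (MeasurableEquiv.measurableEmbedding _)]
      simp only [heq]
      rfl
    have hGc : Measurable fun p : X × (Fin N → X) => G (Fin.cons p.1 p.2) := hG.comp hcons
    have hGx : ∀ x, Measurable fun ω : Fin N → X => G (Fin.cons x ω) := fun x =>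
      hGc.comp (measurable_const.prodMk measurable_id)
    set g : X → ℝ := fun x => ∫ ω, G (Fin.cons x ω) ∂P with hg
    have hgm : Measurable g :=
      (hGc.stronglyMeasurable.integral_prod_right').measurable
    have hgC : ∀ x, |g x| ≤ C := fun x => abs_integral_le_of_bdd P fun ω => hC _
    have hm : ∫ ω, G ω ∂(Measure.pi fun _ : Fin (N+1) => μ) = ∫ x, g x ∂μ := by
      rw [key, integral_prod _ (integrable_of_bdd _ hGc fun p => hC _)]
    rw [key, hm]
    set m := ∫ x, g x ∂μ
    rw [integral_prod _ (integrable_exp_of_bdd _ hGc (fun p => hC _) l m)]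
    have hgd : ∀ x y, g x - g y ≤ c := by
      intro x y
      rw [hg]
      simp only
      rw [← integral_sub (integrable_of_bdd P (hGx x) fun _ => hC _)
        (integrable_of_bdd P (hGx y) fun _ => hC _)]
      calc _ ≤ ∫ ω, c ∂P := by
            refine integral_mono ((integrable_of_bdd P (hGx x) fun _ => hC _).sub
              (integrable_of_bdd P (hGx y) fun _ => hC _)) (integrable_const _) fun ω => ?_
            refine hd 0 _ _ fun k hk => ?_
            obtain ⟨j, rfl⟩ := Fin.exists_succ_eq.2 hk
            simp
        _ = c := by simp
    have hne : Nonempty X := μ.nonempty_of_neZero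
    have hbdd : BddBelow (Set.range g) := ⟨-C, by rintro _ ⟨x, rfl⟩; exact (abs_le.1 (hgC x)).1⟩
    have hIcc : ∀ x, g x ∈ Set.Icc (⨅ y, g y) ((⨅ y, g y) + c) := fun x => by
      refine ⟨ciInf_le hbdd x, ?_⟩
      have : g x - c ≤ ⨅ y, g y := le_ciInf fun y => by linarith [hgd x y]
      linarith
    have hoef := (ProbabilityTheory.hasSubgaussianMGF_of_mem_Icc hgm.aemeasurable
      (Filter.Eventually.of_forall hIcc : ∀ᵐ x ∂μ, _)).mgf_le l
    have hcoef : (((‖(⨅ y, g y) + c - (⨅ y, g y)‖₊ / 2) ^ 2 : NNReal) : ℝ) = (c/2)^2 := by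
      simp [add_sub_cancel_left, abs_of_nonneg hc]
    rw [hcoef, ProbabilityTheory.mgf] at hoef
    calc _ ≤ ∫ x, Real.exp (l * (g x - m)) * Real.exp (N * (c / 2) ^ 2 * l ^ 2 / 2) ∂μ := by
          refine integral_mono
            (integrable_exp_of_bdd (μ.prod P) hGc (fun p => hC _) l m).integral_prod_left
            ((integrable_exp_of_bdd μ hgm hgC l m).mul_const _) fun x => ?_
          have := ih (fun ω => G (Fin.cons x ω)) (hGx x) (fun _ => hC _) (by
            intro n u v huv
            refine hd n.succ _ _ fun k hk => ?_
            refine Fin.cases (by simp) (fun j hj => ?_) k hk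
            simp only [Fin.cons_succ]
            exact huv j (fun h => hj (by rw [h])))
          calc _ = ∫ ω, Real.exp (l * (g x - m)) * Real.exp (l * (G (Fin.cons x ω) - g x)) ∂P := by
                congr 1; ext ω; rw [← Real.exp_add]; congr 1; ring
            _ = Real.exp (l * (g x - m)) * ∫ ω, Real.exp (l * (G (Fin.cons x ω) - g x)) ∂P :=
                integral_const_mul _ _
            _ ≤ _ := by
                gcongr
      _ ≤ Real.exp ((c / 2) ^ 2 * l ^ 2 / 2) * Real.exp (N * (c / 2) ^ 2 * l ^ 2 / 2) := by
          rw [integral_mul_const]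
          gcongr
      _ = _ := by
          rw [← Real.exp_add]; congr 1; push_cast; ring

lemma mcdiarmid {X : Type*} [MeasurableSpace X] (μ : Measure X) [IsProbabilityMeasure μ]
    (B C : ℝ) (hB : 0 < B) (N : ℕ) (hN : 0 < N) (G : (Fin N → X) → ℝ) (hG : Measurable G)
    (hC : ∀ ω, |G ω| ≤ C)
    (hd : ∀ n x y, (∀ m, m ≠ n → x m = y m) → G x - G y ≤ 2 * B / N)
    (t : ℝ) (ht : 0 < t) (ρ : ℝ) (hρ : ∫ ω, G ω ∂(Measure.pi fun _ : Fin N => μ) ≤ ρ) :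
    (Measure.pi fun _ : Fin N => μ).real {ω | ρ + t ≤ G ω}
      ≤ Real.exp (-((N : ℝ) * t ^ 2) / (2 * B ^ 2)) := by
  set P := Measure.pi fun _ : Fin N => μ with hP
  have hN' : (0:ℝ) < N := by exact_mod_cast hN
  have h : ProbabilityTheory.HasSubgaussianMGF (fun ω => G ω - ∫ ω', G ω' ∂P)
      (Real.toNNReal (N * (2 * B / N / 2) ^ 2)) P := by
    refine ⟨fun l => integrable_exp_of_bdd P hG hC l _, fun l => ?_⟩
    rw [Real.coe_toNNReal _ (by positivity)]
    exact mcdiarmid_mgf μ (2 * B / N) C (by positivity) l N G hG hC hd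
  have h2 := h.measure_ge_le ht.le
  rw [Real.coe_toNNReal _ (by positivity)] at h2
  calc _ ≤ P.real {ω | t ≤ G ω - ∫ ω', G ω' ∂P} := by
        refine measureReal_mono (fun ω hω => ?_)
        simp only [Set.mem_ofPred_eq] at *
        linarith
    _ ≤ _ := h2
    _ = _ := by congr 1; field_simp

lemma bdd_of_abs {ι : Type*} {f : ι → ℝ} {C : ℝ} (h : ∀ i, |f i| ≤ C) :
    BddAbove (Set.range f) := ⟨C, by rintro _ ⟨i, rfl⟩; exact (abs_le.1 (h i)).2⟩

lemma abs_iSup_le' {ι : Type*} [Nonempty ι] {f : ι → ℝ} {C : ℝ} (h : ∀ i, |f i| ≤ C) :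
    |⨆ i, f i| ≤ C := by
  obtain ⟨i⟩ := ‹Nonempty ι›
  exact abs_le.2 ⟨(abs_le.1 (h i)).1.trans (le_ciSup (bdd_of_abs h) i),
    ciSup_le fun i => (abs_le.1 (h i)).2⟩

lemma abs_avg_le {N : ℕ} (hN : 0 < N) {f : Fin N → ℝ} {C : ℝ} (h : ∀ n, |f n| ≤ C) :
    |((1 : ℝ) / N) * ∑ n, f n| ≤ C := by
  have hN' : (0:ℝ) < N := by exact_mod_cast hN
  rw [abs_mul, abs_of_nonneg (by positivity)]
  have : |∑ n, f n| ≤ N * C := (Finset.abs_sum_le_sum_abs _ _).trans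
    ((Finset.sum_le_sum fun n _ => h n).trans (by simp))
  calc _ ≤ (1:ℝ)/N * (N * C) := by gcongr
    _ = C := by field_simp

lemma abs_rsign_mul (b : Bool) (x : ℝ) : |rsign b * x| = |x| := by
  cases b <;> simp [rsign]

lemma rsign_not (b : Bool) : rsign (!b) = - rsign b := by
  cases b <;> simp [rsign]

lemma sym1 {X : Type*} [MeasurableSpace X] (μ : Measure X) [IsProbabilityMeasure μ]
    {ι : Type*} [Countable ι] [Nonempty ι]
    (F : ι → X → ℝ) (hF : ∀ i, Measurable (F i))
    (B : ℝ) (hFb : ∀ i x, |F i x| ≤ B)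
    (N : ℕ) (hN : 0 < N) : ∫ ω, (⨆ i, ((∫ x, F i x ∂μ) - ((1 : ℝ) / N) * ∑ n, F i (ω n)))
      ∂(Measure.pi fun _ : Fin N => μ) ≤
    ∫ ω, (⨆ i, ((1 : ℝ) / N) * ∑ n, (F i (ω n).2 - F i (ω n).1))
      ∂(Measure.pi fun _ : Fin N => μ.prod μ) := by
  have hN' : (0:ℝ) < N := by exact_mod_cast hN
  set P := Measure.pi fun _ : Fin N => μ with hP
  have hmp := measurePreserving_arrowProdEquivProdArrow X X (Fin N) (fun _ => μ) (fun _ => μ)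
  have e : ∫ ω, (⨆ i, ((1 : ℝ) / N) * ∑ n, (F i (ω n).2 - F i (ω n).1))
      ∂(Measure.pi fun _ : Fin N => μ.prod μ) =
      ∫ p, (⨆ i, ((1 : ℝ) / N) * ∑ n, (F i (p.2 n) - F i (p.1 n))) ∂(P.prod P) := by
    rw [← hmp.integral_comp (MeasurableEquiv.measurableEmbedding _)]
    rfl
  have hb : ∀ (p : (Fin N → X) × (Fin N → X)) i,
      |((1 : ℝ) / N) * ∑ n, (F i (p.2 n) - F i (p.1 n))| ≤ B + B := fun p i =>
    abs_avg_le hN fun n => (abs_sub _ _).trans (add_le_add (hFb _ _) (hFb _ _))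
  have hmi : ∀ i, Measurable fun p : (Fin N → X) × (Fin N → X) =>
      ((1 : ℝ) / N) * ∑ n, (F i (p.2 n) - F i (p.1 n)) := fun i => by
    have := hF i
    fun_prop
  have hm : Measurable fun p : (Fin N → X) × (Fin N → X) =>
      ⨆ i, ((1 : ℝ) / N) * ∑ n, (F i (p.2 n) - F i (p.1 n)) := Measurable.iSup hmi
  have hint := integrable_of_bdd (P.prod P) hm (fun p => abs_iSup_le' (hb p))
  rw [e, integral_prod _ hint]
  refine integral_mono ?_ hint.integral_prod_left fun ω => ?_
  · refine integrable_of_bdd P (C := B + B) (Measurable.iSup fun i => ?_)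
      fun ω => abs_iSup_le' fun i => ?_
    · have := hF i
      fun_prop
    · exact (abs_sub _ _).trans (add_le_add (abs_integral_le_of_bdd μ (hFb i))
        (abs_avg_le hN fun n => hFb _ _))
  · refine ciSup_le fun i => ?_
    have hFi : ∀ n, Integrable (fun ω' : Fin N → X => F i (ω' n)) P := fun n =>
      integrable_of_bdd P ((hF i).comp (measurable_pi_apply n)) fun _ => hFb _ _
    calc _ = ∫ ω', ((1 : ℝ) / N) * ∑ n, (F i (ω' n) - F i (ω n)) ∂P := by
          rw [integral_const_mul, integral_finsetSum _ fun n _ =>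
            show Integrable (fun ω' : Fin N → X => F i (ω' n) - F i (ω n)) P from
              (hFi n).sub (integrable_const _)]
          have : ∀ n, ∫ ω', (F i (ω' n) - F i (ω n)) ∂P = (∫ x, F i x ∂μ) - F i (ω n) := by
            intro n
            rw [integral_sub (hFi n) (integrable_const _)]
            congr 1
            · exact integral_comp_eval (μ := fun _ : Fin N => μ) (i := n) (f := F i)
                (hF i).aestronglyMeasurable
            · simp
          simp only [this, Finset.sum_sub_distrib]
          simp
          field_simp
      _ ≤ _ := by
          refine integral_mono
            (integrable_of_bdd P ((hmi i).comp (measurable_const.prodMk measurable_id))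
              fun ω' => hb (ω, ω') i)
            (integrable_of_bdd P (hm.comp (measurable_const.prodMk measurable_id))
              fun ω' => abs_iSup_le' (hb (ω, ω'))) fun ω' => ?_
          exact le_ciSup (bdd_of_abs (hb (ω, ω'))) i

lemma sym2 {X : Type*} [MeasurableSpace X] (μ : Measure X) [IsProbabilityMeasure μ]
    {ι : Type*} [Countable ι] [Nonempty ι]
    (F : ι → X → ℝ) (hF : ∀ i, Measurable (F i))
    (B : ℝ) (hFb : ∀ i x, |F i x| ≤ B)
    (N : ℕ) (hN : 0 < N) (s : Fin N → Bool) :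
    ∫ ω, (⨆ i, ((1 : ℝ) / N) * ∑ n, (F i (ω n).2 - F i (ω n).1))
      ∂(Measure.pi fun _ : Fin N => μ.prod μ) ≤
    (∫ ω, (⨆ i, ((1 : ℝ) / N) * ∑ n, rsign (s n) * F i (ω n)) ∂(Measure.pi fun _ : Fin N => μ)) +
    (∫ ω, (⨆ i, ((1 : ℝ) / N) * ∑ n, rsign (!s n) * F i (ω n)) ∂(Measure.pi fun _ : Fin N => μ))
    := by
  set Q := Measure.pi fun _ : Fin N => μ.prod μ with hQ
  have hmeas : ∀ s : Fin N → Bool, Measurable fun ω : Fin N → X =>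
      ⨆ i, ((1 : ℝ) / N) * ∑ n, rsign (s n) * F i (ω n) := fun s => Measurable.iSup fun i => by
    have := hF i
    fun_prop
  have hb : ∀ (s : Fin N → Bool) (ω : Fin N → X) i,
      |((1 : ℝ) / N) * ∑ n, rsign (s n) * F i (ω n)| ≤ B := fun s ω i =>
    abs_avg_le hN fun n => by rw [abs_rsign_mul]; exact hFb _ _
  have h1 : MeasurePreserving (fun (ω : Fin N → X × X) n => (ω n).1) Q
      (Measure.pi fun _ : Fin N => μ) :=
    measurePreserving_pi _ _ (f := fun _ => Prod.fst) fun _ => measurePreserving_fst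
  have h2 : MeasurePreserving (fun (ω : Fin N → X × X) n => (ω n).2) Q
      (Measure.pi fun _ : Fin N => μ) :=
    measurePreserving_pi _ _ (f := fun _ => Prod.snd) fun _ => measurePreserving_snd
  have h3 : MeasurePreserving (fun (ω : Fin N → X × X) n => if s n then ω n else (ω n).swap) Q Q :=
    measurePreserving_pi (fun _ => μ.prod μ) (fun _ => μ.prod μ)
      (f := fun n (p : X × X) => if s n then p else p.swap) fun n => by
      cases s n
      · simpa using! Measure.measurePreserving_swap
      · simpa using! MeasurePreserving.id _
  have hD : Measurable fun ω : Fin N → X × X =>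
      ⨆ i, ((1 : ℝ) / N) * ∑ n, (F i (ω n).2 - F i (ω n).1) := Measurable.iSup fun i => by
    have := hF i
    fun_prop
  have hDb : ∀ (ω : Fin N → X × X) i,
      |((1 : ℝ) / N) * ∑ n, (F i (ω n).2 - F i (ω n).1)| ≤ B + B := fun p i =>
    abs_avg_le hN fun n => (abs_sub _ _).trans (add_le_add (hFb _ _) (hFb _ _))
  have i1 := h2.integrable_comp_of_integrable (integrable_of_bdd _ (hmeas s) fun ω => abs_iSup_le' (hb s ω))
  have i2 := h1.integrable_comp_of_integrable (integrable_of_bdd _ (hmeas (fun n => !s n))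
    fun ω => abs_iSup_le' (hb (fun n => !s n) ω))
  have e1 := integral_map (μ := Q) h2.measurable.aemeasurable
    (f := fun ω => ⨆ i, ((1 : ℝ) / N) * ∑ n, rsign (s n) * F i (ω n))
    (hmeas s).aestronglyMeasurable
  have e2 := integral_map (μ := Q) h1.measurable.aemeasurable
    (f := fun ω => ⨆ i, ((1 : ℝ) / N) * ∑ n, rsign (!s n) * F i (ω n))
    (hmeas fun n => !s n).aestronglyMeasurable
  have e3 := integral_map (μ := Q) h3.measurable.aemeasurable
    (f := fun ω => ⨆ i, ((1 : ℝ) / N) * ∑ n, (F i (ω n).2 - F i (ω n).1))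
    hD.aestronglyMeasurable
  rw [h2.map_eq] at e1
  rw [h1.map_eq] at e2
  rw [h3.map_eq] at e3
  rw [e1, e2, e3]
  refine le_trans ?_ (integral_add i1 i2).le
  refine integral_mono (integrable_of_bdd _ (hD.comp h3.measurable)
    fun ω => abs_iSup_le' (hDb _)) (i1.add i2) fun ω => ?_
  refine ciSup_le fun i => ?_
  calc _ = ((1 : ℝ) / N) * ∑ n, rsign (s n) * F i (ω n).2 +
        ((1 : ℝ) / N) * ∑ n, rsign (!s n) * F i (ω n).1 := by
        rw [← mul_add, ← Finset.sum_add_distrib]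
        congr 2
        ext n
        cases hs : s n <;> simp [rsign, hs]
        all_goals ring
    _ ≤ _ := add_le_add (le_ciSup (bdd_of_abs (hb s fun n => (ω n).2)) i)
        (le_ciSup (bdd_of_abs (hb (fun n => !s n) fun n => (ω n).1)) i)

lemma sym3 {X : Type*} [MeasurableSpace X] (μ : Measure X) [IsProbabilityMeasure μ]
    {ι : Type*} [Countable ι] [Nonempty ι]
    (F : ι → X → ℝ) (hF : ∀ i, Measurable (F i))
    (B : ℝ) (hFb : ∀ i x, |F i x| ≤ B)
    (N : ℕ) (hN : 0 < N) : ∫ ω, (⨆ i, ((∫ x, F i x ∂μ) - ((1 : ℝ) / N) * ∑ n, F i (ω n)))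
      ∂(Measure.pi fun _ : Fin N => μ) ≤
    2 * ∫ ω, (∑ s : Fin N → Bool,
        |⨆ i, ((1 : ℝ) / N) * ∑ n, rsign (s n) * F i (ω n)|) / 2 ^ N
        ∂(Measure.pi fun _ : Fin N => μ) := by
  refine (sym1 μ F hF B hFb N hN).trans ?_
  have hmeas : ∀ s : Fin N → Bool, Measurable fun ω : Fin N → X =>
      ⨆ i, ((1 : ℝ) / N) * ∑ n, rsign (s n) * F i (ω n) := fun s => Measurable.iSup fun i => by
    have := hF i
    fun_prop
  have hb : ∀ (s : Fin N → Bool) (ω : Fin N → X) i,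
      |((1 : ℝ) / N) * ∑ n, rsign (s n) * F i (ω n)| ≤ B := fun s ω i =>
    abs_avg_le hN fun n => by rw [abs_rsign_mul]; exact hFb _ _
  have hint := fun s => integrable_of_bdd (Measure.pi fun _ : Fin N => μ) (hmeas s)
    fun ω => abs_iSup_le' (hb s ω)
  rw [integral_div, integral_finsetSum _ fun s _ => (hint s).abs]
  set D := ∫ ω, (⨆ i, ((1 : ℝ) / N) * ∑ n, (F i (ω n).2 - F i (ω n).1))
      ∂(Measure.pi fun _ : Fin N => μ.prod μ)
  set V : (Fin N → Bool) → ℝ := fun s =>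
    ∫ ω, |⨆ i, ((1 : ℝ) / N) * ∑ n, rsign (s n) * F i (ω n)| ∂(Measure.pi fun _ : Fin N => μ)
    with hV
  have h : ∀ s, D ≤ V s + V (fun n => !s n) := fun s =>
    (sym2 μ F hF B hFb N hN s).trans (add_le_add
      (integral_mono (hint s) (hint s).abs fun ω => le_abs_self _)
      (integral_mono (hint _) (hint _).abs fun ω => le_abs_self _))
  have hs := Finset.sum_le_sum fun s (_ : s ∈ Finset.univ) => h s
  have hflip : ∑ s : Fin N → Bool, V (fun n => !s n) = ∑ s, V s :=
    Function.Bijective.sum_comp (e := fun (s : Fin N → Bool) n => !s n)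
      (Function.Involutive.bijective fun s => by ext; simp) V
  rw [Finset.sum_add_distrib, hflip] at hs
  simp at hs
  rw [← mul_div_assoc, le_div_iff₀ (by positivity)]
  linarith

lemma onesided {X : Type*} [MeasurableSpace X] (μ : Measure X) [IsProbabilityMeasure μ]
    {ι : Type*} [Countable ι] [Nonempty ι]
    (F : ι → X → ℝ) (hF : ∀ i, Measurable (F i))
    (B : ℝ) (hFb : ∀ i x, |F i x| ≤ B)
    (N : ℕ) (hN : 0 < N) (hB : 0 < B) (t : ℝ) (ht : 0 < t) (ρ : ℝ)
    (hρ : ρ = 2 * ∫ ω, (∑ s : Fin N → Bool,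
        |⨆ i, ((1 : ℝ) / N) * ∑ n, rsign (s n) * F i (ω n)|) / 2 ^ N
        ∂(Measure.pi fun _ : Fin N => μ)) :
    (Measure.pi fun _ : Fin N => μ).real
      {ω | ρ + t ≤ ⨆ i, ((∫ x, F i x ∂μ) - ((1 : ℝ) / N) * ∑ n, F i (ω n))}
      ≤ Real.exp (-((N : ℝ) * t ^ 2) / (2 * B ^ 2)) := by
  have hN' : (0:ℝ) < N := by exact_mod_cast hN
  have hb : ∀ (ω : Fin N → X) i, |(∫ x, F i x ∂μ) - ((1 : ℝ) / N) * ∑ n, F i (ω n)| ≤ B + B :=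
    fun ω i => (abs_sub _ _).trans (add_le_add (abs_integral_le_of_bdd μ (hFb i))
        (abs_avg_le hN fun n => hFb _ _))
  refine mcdiarmid μ B (B + B) hB N hN _ (Measurable.iSup fun i => ?_)
    (fun ω => abs_iSup_le' (hb ω)) ?_ t ht ρ (hρ ▸ sym3 μ F hF B hFb N hN)
  · have := hF i
    fun_prop
  · intro n x y hxy
    rw [sub_le_iff_le_add]
    refine ciSup_le fun i => ?_
    have h1 := le_ciSup (bdd_of_abs (hb y)) i
    have h2 : ∑ m, F i (y m) - ∑ m, F i (x m) = F i (y n) - F i (x n) := by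
      rw [← Finset.sum_sub_distrib]
      refine Finset.sum_eq_single n (fun m _ hm => by rw [hxy m hm, sub_self]) (by simp)
    have h3 : ((1 : ℝ) / N) * (F i (y n) - F i (x n)) ≤ 1 / N * (2 * B) := by
      gcongr
      linarith [(abs_le.1 (hFb i (y n))).2, (abs_le.1 (hFb i (x n))).1]
    rw [← h2] at h3
    have : 2 * B / N = 1 / N * (2 * B) := by ring
    rw [this]
    linarith

theorem uniform_deviation_tail
    {X : Type*} [MeasurableSpace X] (μ : Measure X) [IsProbabilityMeasure μ]
    {ι : Type*} [Countable ι] [Nonempty ι]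
    (F : ι → X → ℝ) (hF : ∀ i, Measurable (F i))
    (B : ℝ) (hB : 0 < B) (hFb : ∀ i x, |F i x| ≤ B)
    (N : ℕ) (hN : 0 < N)
    (ρ : ℝ)
    (hρ : ρ = 2 * ∫ ω, (∑ s : Fin N → Bool,
        |⨆ i, ((1 : ℝ) / N) * ∑ n, rsign (s n) * F i (ω n)|) / 2 ^ N
        ∂(Measure.pi fun _ : Fin N => μ))
    (t : ℝ) (ht : 0 < t) :
    ((Measure.pi fun _ : Fin N => μ)
        {ω | (⨆ i, |(∫ x, F i x ∂μ) - ((1 : ℝ) / N) * ∑ n, F i (ω n)|) ≥ ρ + t}).toReal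
      ≤ 2 * Real.exp (-((N : ℝ) * t ^ 2) / (2 * B ^ 2)) := by
  have h1 := onesided μ F hF B hFb N hN hB t ht ρ hρ
  have hρ' : ρ = 2 * ∫ ω, (∑ s : Fin N → Bool,
        |⨆ i, ((1 : ℝ) / N) * ∑ n, rsign (s n) * (fun i x => - F i x) i (ω n)|) / 2 ^ N
        ∂(Measure.pi fun _ : Fin N => μ) := by
    rw [hρ]
    congr 2
    ext ω
    congr 1
    rw [← Function.Bijective.sum_comp (e := fun (s : Fin N → Bool) n => !s n)
      (Function.Involutive.bijective fun s => by ext; simp)]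
    simp [rsign_not]
  have h2 := onesided μ (fun i x => - F i x) (fun i => (hF i).neg) B
    (fun i x => by rw [abs_neg]; exact hFb i x) N hN hB t ht ρ hρ'
  have hb : ∀ (ω : Fin N → X) i, |(∫ x, F i x ∂μ) - ((1 : ℝ) / N) * ∑ n, F i (ω n)| ≤ B + B :=
    fun ω i => (abs_sub _ _).trans (add_le_add (abs_integral_le_of_bdd μ (hFb i))
        (abs_avg_le hN fun n => hFb _ _))
  have hb' : ∀ (ω : Fin N → X) i,
      |(∫ x, - F i x ∂μ) - ((1 : ℝ) / N) * ∑ n, - F i (ω n)| ≤ B + B := fun ω i => by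
    convert hb ω i using 1
    rw [integral_neg, Finset.sum_neg_distrib, ← abs_neg]
    congr 1; ring
  rw [two_mul]
  refine le_trans ?_ (add_le_add h1 h2)
  refine le_trans ?_ (measureReal_union_le _ _)
  refine measureReal_mono (fun ω hω => ?_)
  simp only [Set.mem_ofPred_eq, ge_iff_le, Set.mem_union] at hω ⊢
  rw [← le_max_iff]
  refine hω.trans (ciSup_le fun i => abs_le'.2 ⟨?_, ?_⟩)
  · exact le_max_of_le_left (le_ciSup (bdd_of_abs (hb ω)) i)
  · refine le_max_of_le_right (le_trans (le_of_eq ?_) (le_ciSup (bdd_of_abs (hb' ω)) i))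
    rw [integral_neg, Finset.sum_neg_distrib]
    ring
end
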